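/- For n ≥ 4 and any two bubbles δ₁ = δ_{a₁,λ₁}, δ₂ = δ_{a₂,λ₂} on ℝ^n with a₁, a₂ on the boundary hyperplane, there exists C > 0 (independent of the parameters) such that ∫_{ℝ^n_+} max(δ₁,δ₂)^{4/(n-2)} min(δ₁,δ₂)² dx ≤ C ε₁₂^{n/(n-2)} log(ε₁₂^{-1}) whenever ε₁₂ ≤ 1/2. -/

import Mathlib

open MeasureTheory

lemma aux_one_dim (θ : ℝ) (hθ : 0 < θ) :
    ∫ y in Set.Ioi (0:ℝ), (y + 1) ^ (-1 - 2 * θ) = 1 / (2 * θ) := by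
  have h := (measurePreserving_add_right (volume : Measure ℝ) 1).setIntegral_preimage_emb
    (measurableEmbedding_addRight 1) (fun t : ℝ => t ^ (-1 - 2 * θ)) (Set.Ioi 1)
  have h2 : (fun x : ℝ => x + 1) ⁻¹' Set.Ioi 1 = Set.Ioi 0 := by ext x; simp
  rw [h2] at h
  rw [h, integral_Ioi_rpow_of_lt (by linarith) one_pos, Real.one_rpow]
  have : -1 - 2 * θ + 1 = -(2 * θ) := by ring
  rw [this, neg_div_neg_eq]

lemma aux_integral_bound (n : ℕ) (hn : 4 ≤ n) : ∃ K : ℝ, 0 < K ∧ ∀ θ : ℝ, 0 < θ → θ ≤ 2 →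
    ∫ x : EuclideanSpace ℝ (Fin n), ((1:ℝ) + ‖x‖ ^ 2) ^ (-((n:ℝ) + 2 * θ) / 2) ≤ K / θ := by
  have : Nontrivial (EuclideanSpace ℝ (Fin n)) := by
    have : Nonempty (Fin n) := ⟨⟨0, by omega⟩⟩
    infer_instance
  set V : ℝ := (volume : Measure (EuclideanSpace ℝ (Fin n))).real (Metric.ball 0 1) with hV
  have hV0 : 0 ≤ V := measureReal_nonneg
  refine ⟨(2:ℝ) ^ (((n:ℝ) + 4) / 2) * n * (V + 1), by positivity, fun θ hθ hθ2 => ?_⟩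
  have hfr : Module.finrank ℝ (EuclideanSpace ℝ (Fin n)) = n := by simp
  have hn0 : (0:ℝ) < n := by positivity
  have h1 : ∫ x : EuclideanSpace ℝ (Fin n), ((1:ℝ) + ‖x‖ ^ 2) ^ (-((n:ℝ) + 2 * θ) / 2)
      ≤ ∫ x : EuclideanSpace ℝ (Fin n),
        (2:ℝ) ^ (((n:ℝ) + 2 * θ) / 2) * (1 + ‖x‖) ^ (-((n:ℝ) + 2 * θ)) := by
    apply integral_mono_of_nonneg
    · exact Filter.Eventually.of_forall fun x => by positivity
    · exact (integrable_one_add_norm (by rw [hfr]; linarith)).const_mul _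
    · exact Filter.Eventually.of_forall fun x => rpow_neg_one_add_norm_sq_le x (by linarith)
  refine h1.trans ?_
  rw [integral_const_mul, integral_fun_norm_addHaar volume
    (fun t : ℝ => (1 + t) ^ (-((n:ℝ) + 2 * θ))), hfr]
  have h3 : ∫ y in Set.Ioi (0:ℝ), y ^ (n - 1) • (1 + y) ^ (-((n:ℝ) + 2 * θ)) ≤ 1 / (2 * θ) := by
    rw [← aux_one_dim θ hθ]
    apply integral_mono_of_nonneg
    · refine ae_restrict_of_forall_mem measurableSet_Ioi fun y hy => ?_
      have : 0 < y := hy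
      simp only [Pi.zero_apply, smul_eq_mul]; positivity
    · exact integrableOn_add_rpow_Ioi_of_lt (by linarith) (by norm_num)
    · refine ae_restrict_of_forall_mem measurableSet_Ioi fun y hy => ?_
      have hy : 0 < y := hy
      simp only [smul_eq_mul]
      have e : (y + 1) ^ (-1 - 2 * θ) = (1 + y) ^ (n - 1) * (1 + y) ^ (-((n:ℝ) + 2 * θ)) := by
        rw [← Real.rpow_natCast, ← Real.rpow_add (by positivity), add_comm y 1]
        congr 1
        rw [Nat.cast_sub (by omega)]; push_cast; ring
      rw [e]
      gcongr
      linarith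
  rw [nsmul_eq_mul, smul_eq_mul]
  have h4 : (2:ℝ) ^ (((n:ℝ) + 2 * θ) / 2) ≤ (2:ℝ) ^ (((n:ℝ) + 4) / 2) :=
    Real.rpow_le_rpow_of_exponent_le (by norm_num) (by linarith)
  have h5 : 1 / (2 * θ) ≤ 1 / θ := by
    apply one_div_le_one_div_of_le hθ; linarith
  have h6 := h3.trans h5
  calc _ ≤ (2:ℝ) ^ (((n:ℝ) + 4) / 2) * (n * (V * (1 / θ))) := by
        refine mul_le_mul h4 (by gcongr) ?_ (by positivity)
        refine mul_nonneg hn0.le (mul_nonneg hV0 ?_)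
        refine setIntegral_nonneg measurableSet_Ioi fun y hy => ?_
        have hy : 0 < y := hy
        simp only [smul_eq_mul]; positivity
    _ ≤ (2:ℝ) ^ (((n:ℝ) + 4) / 2) * (n * ((V + 1) * (1 / θ))) := by
        gcongr; linarith
    _ = _ := by ring

lemma aux_scaled (n : ℕ) (θ : ℝ) (hθ : 0 < θ) (lam : ℝ) (hl : 0 < lam)
    (a : EuclideanSpace ℝ (Fin n)) :
    Integrable (fun x => lam ^ n * (1 + lam ^ 2 * ‖x - a‖ ^ 2) ^ (-((n:ℝ) + 2 * θ) / 2)) ∧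
    ∫ x, lam ^ n * (1 + lam ^ 2 * ‖x - a‖ ^ 2) ^ (-((n:ℝ) + 2 * θ) / 2) =
    ∫ x : EuclideanSpace ℝ (Fin n), ((1:ℝ) + ‖x‖ ^ 2) ^ (-((n:ℝ) + 2 * θ) / 2) := by
  have hfr : Module.finrank ℝ (EuclideanSpace ℝ (Fin n)) = n := by simp
  set f : EuclideanSpace ℝ (Fin n) → ℝ := fun x => ((1:ℝ) + ‖x‖ ^ 2) ^ (-((n:ℝ) + 2 * θ) / 2)
    with hf
  have hfi : Integrable f := integrable_rpow_neg_one_add_norm_sq (by rw [hfr]; linarith)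
  have e : (fun x => lam ^ n * (1 + lam ^ 2 * ‖x - a‖ ^ 2) ^ (-((n:ℝ) + 2 * θ) / 2))
      = fun x => lam ^ n * f (lam • (x - a)) := by
    ext x
    simp only [hf, norm_smul, mul_pow, Real.norm_eq_abs, sq_abs]
  rw [e]
  refine ⟨((hfi.comp_smul hl.ne').comp_sub_right a).const_mul _, ?_⟩
  rw [integral_const_mul, integral_sub_right_eq_self (fun x => f (lam • x)) a,
    Measure.integral_comp_smul, hfr, abs_of_pos (by positivity), smul_eq_mul, ← mul_assoc,
    mul_inv_cancel₀ (by positivity), one_mul]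

/-- the case `X ≥ Y` -/
lemma aux_case (N θ q X Y lam mu A : ℝ) (hq : 2 ≤ q) (hθ : θ = 1 / Real.log q) (hN : 4 ≤ N)
    (hθ0 : 0 < θ) (hθ2 : θ ≤ 2)
    (hl : 0 < lam) (hm : 0 < mu) (hA : 0 < A) (hY : Y = mu / lam * A) (hXY : Y ≤ X)
    (hX : q / 4 ≤ X) (hr : lam / mu ≤ q) :
    (lam * mu) ^ (N / 2) * (X * Y) ^ (-(N / 2)) ≤
      (4:ℝ) ^ (N / 2) * Real.exp 2 * q ^ (-(N / 2)) * (lam ^ N * A ^ (-(N + 2 * θ) / 2)) := by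
  have hY0 : 0 < Y := by rw [hY]; positivity
  have hq0 : 0 < q := by linarith
  have hX0 : 0 < X := by linarith
  have hlq : 0 < Real.log q := Real.log_pos (by linarith)
  have hqθ : q ^ θ = Real.exp 1 := by
    rw [Real.rpow_def_of_pos hq0, hθ, mul_one_div_cancel hlq.ne']
  have h1 : X ^ (-(N / 2)) ≤ (q / 4) ^ (-(N / 2) + θ) * Y ^ (-θ) := by
    have : X ^ (-(N / 2)) = X ^ (-(N / 2) + θ) * X ^ (-θ) := by
      rw [← Real.rpow_add hX0]; congr 1; ring
    rw [this]
    have ha := Real.rpow_le_rpow_of_nonpos (z := -(N / 2) + θ) (by positivity) hX (by linarith)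
    have hb := Real.rpow_le_rpow_of_nonpos (z := -θ) hY0 hXY (by linarith)
    gcongr
  have h2 : (q / 4) ^ (-(N / 2) + θ) ≤ (4:ℝ) ^ (N / 2) * q ^ (-(N / 2)) * Real.exp 1 := by
    rw [Real.rpow_add (by positivity), Real.div_rpow hq0.le (by norm_num), Real.rpow_neg (x := 4) (by norm_num),
      div_inv_eq_mul, mul_comm ((4:ℝ) ^ _)]
    gcongr
    rw [← hqθ]
    gcongr
    linarith
  have h3 : (lam * mu) ^ (N / 2) * (Y ^ (-θ) * Y ^ (-(N / 2))) =
      (lam / mu) ^ θ * (lam ^ N * A ^ (-(N + 2 * θ) / 2)) := by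
    have e1 : Y ^ (-θ) * Y ^ (-(N / 2)) = Y ^ (-(N + 2 * θ) / 2) := by
      rw [← Real.rpow_add hY0]; congr 1; ring
    rw [e1, hY, Real.mul_rpow (by positivity) hA.le, Real.mul_rpow hl.le hm.le,
      Real.div_rpow hm.le hl.le, Real.div_rpow hl.le hm.le]
    have e2 : mu ^ (N / 2) * mu ^ (-(N + 2 * θ) / 2) = (mu ^ θ)⁻¹ := by
      rw [← Real.rpow_add hm, ← Real.rpow_neg hm.le]; congr 1; ring
    have e3 : lam ^ (N / 2) * (lam ^ (-(N + 2 * θ) / 2))⁻¹ = lam ^ θ * lam ^ N := by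
      rw [← Real.rpow_neg hl.le, ← Real.rpow_add hl, ← Real.rpow_add hl]; congr 1; ring
    calc _ = (mu ^ (N / 2) * mu ^ (-(N + 2 * θ) / 2)) *
          (lam ^ (N / 2) * (lam ^ (-(N + 2 * θ) / 2))⁻¹) * A ^ (-(N + 2 * θ) / 2) := by
            rw [div_eq_mul_inv]; ring
      _ = _ := by rw [e2, e3]; ring
  have h4 : (lam / mu) ^ θ ≤ Real.exp 1 := by
    rw [← hqθ]; gcongr
  have h5 : Real.exp 2 = Real.exp 1 * Real.exp 1 := by rw [← Real.exp_add]; norm_num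
  calc (lam * mu) ^ (N / 2) * (X * Y) ^ (-(N / 2))
      = X ^ (-(N / 2)) * ((lam * mu) ^ (N / 2) * Y ^ (-(N / 2))) := by
        rw [Real.mul_rpow hX0.le hY0.le]; ring
    _ ≤ ((4:ℝ) ^ (N / 2) * q ^ (-(N / 2)) * Real.exp 1 * Y ^ (-θ)) *
        ((lam * mu) ^ (N / 2) * Y ^ (-(N / 2))) := by
        gcongr
        exact h1.trans (by gcongr)
    _ = (4:ℝ) ^ (N / 2) * q ^ (-(N / 2)) * Real.exp 1 *
        ((lam * mu) ^ (N / 2) * (Y ^ (-θ) * Y ^ (-(N / 2)))) := by ring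
    _ = (4:ℝ) ^ (N / 2) * q ^ (-(N / 2)) * Real.exp 1 *
        ((lam / mu) ^ θ * (lam ^ N * A ^ (-(N + 2 * θ) / 2))) := by rw [h3]
    _ ≤ (4:ℝ) ^ (N / 2) * q ^ (-(N / 2)) * Real.exp 1 *
        (Real.exp 1 * (lam ^ N * A ^ (-(N + 2 * θ) / 2))) := by gcongr
    _ = _ := by rw [h5]; ring

/-- `max^{4/(n-2)} min^2 ≤ (product)^{n/(n-2)}` -/
lemma aux_maxmin (N u v : ℝ) (hN : 4 ≤ N) (hu : 0 < u) (hv : 0 < v) :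
    max u v ^ (4 / (N - 2)) * min u v ^ 2 ≤ (u * v) ^ (N / (N - 2)) := by
  rw [← max_mul_min u v]
  have hm : 0 < min u v := lt_min hu hv
  have hle : min u v ≤ max u v := min_le_max
  generalize max u v = M at *
  generalize min u v = m at *
  have hM : 0 < M := by linarith
  have hN2 : 0 < N - 2 := by linarith
  rw [Real.mul_rpow hM.le hm.le]
  have e1 : m ^ 2 = m ^ ((N - 4) / (N - 2)) * m ^ (N / (N - 2)) := by
    rw [← Real.rpow_add hm, ← Real.rpow_natCast]; congr 1; push_cast; field_simp; ring
  have e2 : M ^ (N / (N - 2)) = M ^ (4 / (N - 2)) * M ^ ((N - 4) / (N - 2)) := by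
    rw [← Real.rpow_add hM]; congr 1; field_simp; ring
  have h0 : 0 ≤ (N - 4) / (N - 2) := div_nonneg (by linarith) hN2.le
  rw [e1, e2, ← mul_assoc]
  gcongr

/-- Pointwise bound. -/
lemma aux_pointwise {E : Type*} [NormedAddCommGroup E] [InnerProductSpace ℝ E]
    (N θ q lam₁ lam₂ : ℝ) (a₁ a₂ x : E) (h₁ : 0 < lam₁) (h₂ : 0 < lam₂)
    (hqe : q = lam₁ / lam₂ + lam₂ / lam₁ + lam₁ * lam₂ * ‖a₁ - a₂‖ ^ 2)
    (hq : 2 ≤ q) (hθ : θ = 1 / Real.log q) (hN : 4 ≤ N)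
    (hθ0 : 0 < θ) (hθ2 : θ ≤ 2) :
    (lam₁ * lam₂ / ((1 + lam₁ ^ 2 * ‖x - a₁‖ ^ 2) * (1 + lam₂ ^ 2 * ‖x - a₂‖ ^ 2))) ^ (N / 2) ≤
      (4:ℝ) ^ (N / 2) * Real.exp 2 * q ^ (-(N / 2)) *
      (lam₁ ^ N * (1 + lam₁ ^ 2 * ‖x - a₁‖ ^ 2) ^ (-(N + 2 * θ) / 2)
        + lam₂ ^ N * (1 + lam₂ ^ 2 * ‖x - a₂‖ ^ 2) ^ (-(N + 2 * θ) / 2)) := by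
  set A := 1 + lam₁ ^ 2 * ‖x - a₁‖ ^ 2 with hA
  set B := 1 + lam₂ ^ 2 * ‖x - a₂‖ ^ 2 with hB
  have hA0 : 0 < A := by positivity
  have hB0 : 0 < B := by positivity
  have hq0 : 0 < q := by linarith
  have hn : ‖a₁ - a₂‖ ^ 2 ≤ 2 * (‖x - a₁‖ ^ 2 + ‖x - a₂‖ ^ 2) := by
    have : ‖a₁ - a₂‖ ≤ ‖x - a₁‖ + ‖x - a₂‖ := by
      have := norm_sub_le (x - a₂) (x - a₁)
      rw [sub_sub_sub_cancel_left] at this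
      linarith
    nlinarith [norm_nonneg (a₁ - a₂), sq_nonneg (‖x - a₁‖ - ‖x - a₂‖)]
  have hP : 0 < lam₁ * lam₂ := by positivity
  have hd1 : 0 < lam₁ / lam₂ := by positivity
  have hd2 : 0 < lam₂ / lam₁ := by positivity
  have hX : lam₁ / lam₂ * B = lam₁ / lam₂ + lam₁ * lam₂ * ‖x - a₂‖ ^ 2 := by
    rw [hB]; field_simp
  have hY : lam₂ / lam₁ * A = lam₂ / lam₁ + lam₁ * lam₂ * ‖x - a₁‖ ^ 2 := by
    rw [hA]; field_simp
  have hsum : q / 2 ≤ lam₁ / lam₂ * B + lam₂ / lam₁ * A := by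
    rw [hX, hY, hqe]
    have := mul_le_mul_of_nonneg_left hn hP.le
    nlinarith
  have hr1 : lam₁ / lam₂ ≤ q := by
    rw [hqe]; have : 0 ≤ lam₁ * lam₂ * ‖a₁ - a₂‖ ^ 2 := by positivity
    linarith
  have hr2 : lam₂ / lam₁ ≤ q := by
    rw [hqe]; have : 0 ≤ lam₁ * lam₂ * ‖a₁ - a₂‖ ^ 2 := by positivity
    linarith
  have e : (lam₁ * lam₂ / (A * B)) ^ (N / 2) = (lam₁ * lam₂) ^ (N / 2) *
      ((lam₁ / lam₂ * B) * (lam₂ / lam₁ * A)) ^ (-(N / 2)) := by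
    have : (lam₁ / lam₂ * B) * (lam₂ / lam₁ * A) = A * B := by field_simp
    rw [this, Real.div_rpow hP.le (by positivity), Real.rpow_neg (by positivity), div_eq_mul_inv]
  rw [e]
  rcases le_total (lam₂ / lam₁ * A) (lam₁ / lam₂ * B) with h | h
  · refine (aux_case N θ q _ _ lam₁ lam₂ A hq hθ hN hθ0 hθ2 h₁ h₂ hA0 rfl h
      (by linarith) hr1).trans ?_
    gcongr
    have : 0 ≤ lam₂ ^ N * B ^ (-(N + 2 * θ) / 2) := by positivity
    linarith
  · rw [mul_comm lam₁ lam₂, mul_comm (lam₁ / lam₂ * B)]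
    refine (aux_case N θ q _ _ lam₂ lam₁ B hq hθ hN hθ0 hθ2 h₂ h₁ hB0 rfl h
      (by linarith) hr2).trans ?_
    gcongr
    have : 0 ≤ lam₁ ^ N * A ^ (-(N + 2 * θ) / 2) := by positivity
    linarith

/-- for two boundary-centered bubbles on `ℝⁿ₊`,
`∫_{ℝⁿ₊} max(δ₁,δ₂)^{4/(n-2)} min(δ₁,δ₂)² ≤ C ε₁₂^{n/(n-2)} log(ε₁₂⁻¹)`
whenever `ε₁₂ ≤ 1/2`. -/
theorem interaction_integral_estimate (n : ℕ) (hn : 4 ≤ n)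
    (c₀ : ℝ) (hc₀ : c₀ = ((n : ℝ) * ((n : ℝ) - 2)) ^ (((n : ℝ) - 2) / 4)) :
    ∃ C : ℝ, 0 < C ∧
      ∀ (a₁ a₂ : EuclideanSpace ℝ (Fin n)) (lam₁ lam₂ ε : ℝ)
        (δ₁ δ₂ : EuclideanSpace ℝ (Fin n) → ℝ),
        a₁ ⟨n - 1, by omega⟩ = 0 → a₂ ⟨n - 1, by omega⟩ = 0 →
        0 < lam₁ → 0 < lam₂ →
        (∀ x, δ₁ x = c₀ * lam₁ ^ (((n : ℝ) - 2) / 2) /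
          (1 + lam₁ ^ 2 * ‖x - a₁‖ ^ 2) ^ (((n : ℝ) - 2) / 2)) →
        (∀ x, δ₂ x = c₀ * lam₂ ^ (((n : ℝ) - 2) / 2) /
          (1 + lam₂ ^ 2 * ‖x - a₂‖ ^ 2) ^ (((n : ℝ) - 2) / 2)) →
        ε = (lam₁ / lam₂ + lam₂ / lam₁ + lam₁ * lam₂ * ‖a₁ - a₂‖ ^ 2)
          ^ (-(((n : ℝ) - 2) / 2)) →
        ε ≤ 1 / 2 →
        (∫ x : EuclideanSpace ℝ (Fin n) in
            {x : EuclideanSpace ℝ (Fin n) | 0 < x ⟨n - 1, by omega⟩},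
            max (δ₁ x) (δ₂ x) ^ ((4 : ℝ) / ((n : ℝ) - 2)) * min (δ₁ x) (δ₂ x) ^ 2)
          ≤ C * ε ^ ((n : ℝ) / ((n : ℝ) - 2)) * Real.log ε⁻¹ := by
  obtain ⟨K, hK, hKb⟩ := aux_integral_bound n hn
  have hN : (4:ℝ) ≤ n := by exact_mod_cast hn
  have hN2 : (0:ℝ) < (n:ℝ) - 2 := by linarith
  have hc : 0 < c₀ := by rw [hc₀]; positivity
  set s : ℝ := (n:ℝ) / ((n:ℝ) - 2) with hs
  set D : ℝ := (c₀ * c₀) ^ s * ((4:ℝ) ^ ((n:ℝ) / 2) * Real.exp 2) with hD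
  have hD0 : 0 < D := by positivity
  refine ⟨D * (2 * K) * (2 / ((n:ℝ) - 2)), by positivity, ?_⟩
  intro a₁ a₂ lam₁ lam₂ ε δ₁ δ₂ _ _ h₁ h₂ hδ₁ hδ₂ hε _
  set q : ℝ := lam₁ / lam₂ + lam₂ / lam₁ + lam₁ * lam₂ * ‖a₁ - a₂‖ ^ 2 with hqe
  have hq : 2 ≤ q := by
    have h3 : 2 ≤ lam₁ / lam₂ + lam₂ / lam₁ := by
      rw [div_add_div _ _ h₂.ne' h₁.ne', le_div_iff₀ (by positivity)]
      nlinarith [sq_nonneg (lam₁ - lam₂)]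
    have h4 : 0 ≤ lam₁ * lam₂ * ‖a₁ - a₂‖ ^ 2 := by positivity
    linarith
  have hq0 : 0 < q := by linarith
  have hlog : 1 / 2 ≤ Real.log q := by
    have := Real.log_le_log (by norm_num) hq
    linarith [Real.log_two_gt_d9]
  have hlog0 : 0 < Real.log q := by linarith
  set θ : ℝ := 1 / Real.log q with hθ
  have hθ0 : 0 < θ := by positivity
  have hθ2 : θ ≤ 2 := by
    rw [hθ, div_le_iff₀ hlog0]; linarith
  have hεs : ε ^ s = q ^ (-((n:ℝ) / 2)) := by
    rw [hε, ← Real.rpow_mul hq0.le]; congr 1; rw [hs]; field_simp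
  have hεl : Real.log ε⁻¹ = ((n:ℝ) - 2) / 2 * Real.log q := by
    rw [Real.log_inv, hε, Real.log_rpow hq0]; ring
  obtain ⟨i1, e1⟩ := aux_scaled n θ hθ0 lam₁ h₁ a₁
  obtain ⟨i2, e2⟩ := aux_scaled n θ hθ0 lam₂ h₂ a₂
  have hp : ∀ x, max (δ₁ x) (δ₂ x) ^ ((4 : ℝ) / ((n : ℝ) - 2)) * min (δ₁ x) (δ₂ x) ^ 2 ≤
      D * q ^ (-((n:ℝ) / 2)) *
      (lam₁ ^ n * (1 + lam₁ ^ 2 * ‖x - a₁‖ ^ 2) ^ (-((n:ℝ) + 2 * θ) / 2)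
        + lam₂ ^ n * (1 + lam₂ ^ 2 * ‖x - a₂‖ ^ 2) ^ (-((n:ℝ) + 2 * θ) / 2)) := by
    intro x
    have hpt := aux_pointwise (n:ℝ) θ q lam₁ lam₂ a₁ a₂ x h₁ h₂ hqe hq hθ hN hθ0 hθ2
    have hd1 : 0 < δ₁ x := by rw [hδ₁]; positivity
    have hd2 : 0 < δ₂ x := by rw [hδ₂]; positivity
    refine (aux_maxmin (n:ℝ) _ _ hN hd1 hd2).trans ?_
    rw [Real.rpow_natCast, Real.rpow_natCast] at hpt
    have e : (δ₁ x * δ₂ x) ^ s = (c₀ * c₀) ^ s * (lam₁ * lam₂ /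
        ((1 + lam₁ ^ 2 * ‖x - a₁‖ ^ 2) * (1 + lam₂ ^ 2 * ‖x - a₂‖ ^ 2))) ^ ((n:ℝ) / 2) := by
      have e0 : ((n:ℝ) / 2) = (((n:ℝ) - 2) / 2) * s := by rw [hs]; field_simp
      rw [e0, Real.rpow_mul (by positivity), ← Real.mul_rpow (by positivity) (by positivity),
        hδ₁, hδ₂, Real.div_rpow (by positivity) (by positivity), Real.mul_rpow h₁.le h₂.le,
        Real.mul_rpow (x := 1 + lam₁ ^ 2 * ‖x - a₁‖ ^ 2) (by positivity) (by positivity)]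
      congr 1
      rw [div_mul_div_comm, ← mul_div_assoc]; congr 1; ring
    rw [e, hD]
    refine (mul_le_mul_of_nonneg_left hpt (by positivity)).trans (le_of_eq ?_)
    ring
  have hgi := (i1.add i2).const_mul (D * q ^ (-((n:ℝ) / 2)))
  have hnn : ∀ x, 0 ≤ max (δ₁ x) (δ₂ x) ^ ((4 : ℝ) / ((n : ℝ) - 2)) * min (δ₁ x) (δ₂ x) ^ 2 := by
    intro x
    have hd1 : 0 < δ₁ x := by rw [hδ₁]; positivity
    have := hd1.trans_le (le_max_left (δ₁ x) (δ₂ x))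
    positivity
  calc _ ≤ ∫ x in {x : EuclideanSpace ℝ (Fin n) | 0 < x ⟨n - 1, by omega⟩}, _ :=
        integral_mono_of_nonneg (Filter.Eventually.of_forall hnn) hgi.integrableOn
          (Filter.Eventually.of_forall hp)
    _ ≤ _ := setIntegral_le_integral hgi
          (Filter.Eventually.of_forall fun x => (hnn x).trans (hp x))
    _ ≤ D * q ^ (-((n:ℝ) / 2)) * (K / θ + K / θ) := by
        rw [integral_const_mul]
        have := integral_add i1 i2
        simp only [Pi.add_apply]
        rw [this, e1, e2]
        have := hKb θ hθ0 hθ2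
        gcongr
    _ = _ := by
        rw [hεs, hεl, hθ]; field_simp; ring
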